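/- (Bramble–Hilbert with explicit constant.) Let d ∈ ℕ, d ≥ 1, m ∈ ℕ, m ≥ 1, and let Υ ⊂ ℝ^{d+1} be open and bounded with diameter h_Υ, star-shaped with respect to the open ball B := B_{ρ h_Υ}(z_0,s_0) ⊆ Υ (i.e., star-shaped with respect to every point of B) for some 0 < ρ ≤ 1/2. Let φ ∈ C^m(Υ;ℂ) be such that D^jφ ∈ L²(Υ) for all |j| ≤ m, and define the averaged Taylor polynomial Q^m φ(x,t) := (1/|B|) ∫_B T^m_{(z,s)}φ(x,t) d(z,s). Then for every integer s with 0 ≤ s < m, |φ − Q^m φ|_{H^s(Υ)} ≤ 2·C(d+s,d)·((d+1)^{m−s}/(m−s−1)!)·(h_Υ^{m−s}/ρ^{(d+1)/2})·|φ|_{H^m(Υ)}, where C(d+s,d) is the binomial coefficient. -/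

import Mathlib

open scoped BigOperators
open MeasureTheory

noncomputable section

/-- Space–time points `(x, t)` with `x ∈ ℝ^d`, `t ∈ ℝ`. -/
abbrev Pt (d : ℕ) : Type := (Fin d → ℝ) × ℝ

/-- Multi-indices `j = (j_x, j_t)`. -/
abbrev MI (d : ℕ) : Type := (Fin d → ℕ) × ℕ

/-- `|j|`, the total order of a multi-index. -/
def MI.deg {d : ℕ} (j : MI d) : ℕ := (∑ ℓ, j.1 ℓ) + j.2

/-- `j!`. -/
def MI.fact {d : ℕ} (j : MI d) : ℕ := (∏ ℓ, Nat.factorial (j.1 ℓ)) * Nat.factorial j.2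

/-- componentwise difference of multi-indices. -/
def MI.sub {d : ℕ} (j z : MI d) : MI d := (fun ℓ => j.1 ℓ - z.1 ℓ, j.2 - z.2)

/-- add `k` to the spatial component `ℓ` of a multi-index. -/
def MI.addX {d : ℕ} (j : MI d) (ℓ : Fin d) (k : ℕ) : MI d :=
  (fun m => j.1 m + if m = ℓ then k else 0, j.2)

/-- spatial canonical basis vector in `ℝ^d`. -/
def eVecd (d : ℕ) (ℓ : Fin d) : Fin d → ℝ := fun m => if m = ℓ then 1 else 0

/-- spatial unit direction in space–time. -/
def eDir (d : ℕ) (ℓ : Fin d) : Pt d := (eVecd d ℓ, 0)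

/-- time unit direction in space–time. -/
def tDir (d : ℕ) : Pt d := (0, 1)

/-- directional (partial) derivative. -/
def pd {d : ℕ} (v : Pt d) (f : Pt d → ℂ) : Pt d → ℂ := fun z => fderiv ℝ f z v

/-- the multi-index partial derivative `D^j = ∂_{x_1}^{j_1} ⋯ ∂_{x_d}^{j_d} ∂_t^{j_t}`. -/
def Dmi {d : ℕ} (j : MI d) (f : Pt d → ℂ) : Pt d → ℂ :=
  (List.finRange d).foldr (fun ℓ g => (pd (eDir d ℓ))^[j.1 ℓ] g) ((pd (tDir d))^[j.2] f)

/-- the Schrödinger operator `S f = i ∂_t f + ½ Δ_x f − V f`. -/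
def Sop {d : ℕ} (V : Pt d → ℝ) (f : Pt d → ℂ) : Pt d → ℂ := fun z =>
  Complex.I * pd (tDir d) f z
    + (1 / 2) * ∑ ℓ : Fin d, pd (eDir d ℓ) (pd (eDir d ℓ) f) z
    - (V z : ℂ) * f z

/-- all multi-indices with every component `≤ p`. -/
def MIall (d p : ℕ) : Finset (MI d) :=
  (Finset.univ : Finset ((Fin d → Fin (p + 1)) × Fin (p + 1))).image
    (fun j => ((fun ℓ => (j.1 ℓ : ℕ)), (j.2 : ℕ)))

/-- multi-indices with `|j| ≤ p`. -/
def MIle (d p : ℕ) : Finset (MI d) := (MIall d p).filter (fun j => MI.deg j ≤ p)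

/-- multi-indices with `|j| < m`. -/
def MIlt (d m : ℕ) : Finset (MI d) := (MIall d m).filter (fun j => MI.deg j < m)

/-- multi-indices with `|j| = m`. -/
def MIeq (d m : ℕ) : Finset (MI d) := (MIall d m).filter (fun j => MI.deg j = m)

/-- multi-indices `z ≤ j` (componentwise). -/
def MIbelow {d : ℕ} (j : MI d) : Finset (MI d) :=
  (MIall d (MI.deg j)).filter (fun z => (∀ ℓ, z.1 ℓ ≤ j.1 ℓ) ∧ z.2 ≤ j.2)

/-- monomial of multi-index `j`, centered at `c`, scaled by `h`. -/
def monoC {d : ℕ} (c : Pt d) (h : ℝ) (j : MI d) : Pt d → ℂ := fun z =>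
  (∏ ℓ, (((z.1 ℓ - c.1 ℓ) / h : ℝ) : ℂ) ^ j.1 ℓ) * (((z.2 - c.2) / h : ℝ) : ℂ) ^ j.2

/-- `ℙ^p`: polynomial functions `ℝ^{d+1} → ℂ` of total degree `≤ p`. -/
def PolySet (d p : ℕ) : Set (Pt d → ℂ) :=
  {q | ∃ C : MI d → ℂ, ∀ z, q z = ∑ j ∈ MIle d p, C j * monoC ((0 : Fin d → ℝ), (0 : ℝ)) 1 j z}

/-- the quasi-Trefftz space `QT^p(K)` for the potential `V`, centered at `c`:
polynomials of degree `≤ p` with `D^j(Sq)(c) = 0` for all `|j| ≤ p − 2`. -/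
def QTset (d p : ℕ) (V : Pt d → ℝ) (c : Pt d) : Set (Pt d → ℂ) :=
  {q | q ∈ PolySet d p ∧ ∀ j : MI d, MI.deg j + 2 ≤ p → Dmi j (Sop V q) c = 0}

/-- Taylor polynomial of order `m` (degree `m − 1`) centered at `c`. -/
def TaylorP {d : ℕ} (m : ℕ) (c : Pt d) (φ : Pt d → ℂ) : Pt d → ℂ := fun z =>
  ∑ j ∈ MIlt d m, ((MI.fact j : ℂ))⁻¹ * Dmi j φ c * monoC c 1 j z

/-- Euclidean distance on `ℝ^{d+1} = ℝ^d × ℝ`. -/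
def eDist {d : ℕ} (z w : Pt d) : ℝ :=
  Real.sqrt ((∑ ℓ, (z.1 ℓ - w.1 ℓ) ^ 2) + (z.2 - w.2) ^ 2)

/-- The index set of the `d + 1` coordinate directions: `none` is time, `some ℓ` is space. -/
abbrev Dir (d : ℕ) : Type := Option (Fin d)

namespace MI

/-- The component of a multi-index in a coordinate direction. -/
def comp {d : ℕ} (j : MI d) : Dir d → ℕ
  | none => j.2
  | some ℓ => j.1 ℓ

/-- The multi-index of a first order derivative. -/
def unit {d : ℕ} : Dir d → MI d
  | none => (0, 1)
  | some ℓ => (Pi.single ℓ 1, 0)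

@[simp] lemma comp_add {d : ℕ} (j k : MI d) (o : Dir d) :
    (j + k).comp o = j.comp o + k.comp o := by
  cases o <;> rfl

@[simp] lemma comp_zero {d : ℕ} (o : Dir d) : (0 : MI d).comp o = 0 := by
  cases o <;> rfl

lemma comp_unit {d : ℕ} (o o' : Dir d) : (unit o).comp o' = if o' = o then 1 else 0 := by
  cases o <;> cases o' <;> simp [unit, comp, Pi.single_apply]

lemma comp_injective {d : ℕ} : Function.Injective (comp (d := d)) := fun _ _ h =>
  Prod.ext (funext fun ℓ => congrFun h (some ℓ)) (congrFun h none)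

lemma deg_eq {d : ℕ} (j : MI d) : j.deg = ∑ o, j.comp o := by
  simp [deg, Fintype.sum_option, comp, add_comm]

lemma fact_eq {d : ℕ} (j : MI d) : j.fact = ∏ o, (j.comp o).factorial := by
  simp [fact, Fintype.prod_option, comp, mul_comm]

@[simp] lemma deg_zero {d : ℕ} : (0 : MI d).deg = 0 := by simp [deg_eq]

@[simp] lemma fact_zero {d : ℕ} : (0 : MI d).fact = 1 := by simp [fact_eq]

lemma deg_add {d : ℕ} (j k : MI d) : (j + k).deg = j.deg + k.deg := by
  simp [deg_eq, Finset.sum_add_distrib]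

@[simp] lemma deg_unit {d : ℕ} (o : Dir d) : (unit o).deg = 1 := by
  simp [deg_eq, comp_unit]

lemma fact_pos {d : ℕ} (j : MI d) : 0 < j.fact := by
  rw [fact_eq]; exact Finset.prod_pos fun o _ => Nat.factorial_pos _

lemma comp_le_deg {d : ℕ} (j : MI d) (o : Dir d) : j.comp o ≤ j.deg := by
  rw [deg_eq]; exact Finset.single_le_sum (fun _ _ => Nat.zero_le _) (Finset.mem_univ o)

lemma eq_zero_of_deg_eq_zero {d : ℕ} {j : MI d} (h : j.deg = 0) : j = 0 :=
  comp_injective <| funext fun o => by have := j.comp_le_deg o; rw [comp_zero]; omega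

/-- The monomial `u ^ k`. -/
def pow {d : ℕ} {R : Type*} [CommSemiring R] (u : Dir d → R) (k : MI d) : R :=
  ∏ o, u o ^ k.comp o

@[simp] lemma pow_zero {d : ℕ} {R : Type*} [CommSemiring R] (u : Dir d → R) : pow u 0 = 1 := by
  simp [pow]

lemma pow_add_unit {d : ℕ} {R : Type*} [CommSemiring R] (u : Dir d → R) (k : MI d) (o : Dir d) :
    pow u (k + unit o) = pow u k * u o := by
  simp only [pow, comp_add, pow_add, Finset.prod_mul_distrib]
  congr 1
  simp [comp_unit]

lemma fact_add_unit {d : ℕ} (k : MI d) (o : Dir d) :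
    (k + unit o).fact = (k + unit o).comp o * k.fact := by
  rw [fact_eq, fact_eq, ← Finset.mul_prod_erase _ _ (Finset.mem_univ o),
    ← Finset.mul_prod_erase (a := o) _ (fun o => (k.comp o).factorial) (Finset.mem_univ o),
    ← mul_assoc]
  congr 1
  · simp [comp_unit, Nat.factorial_succ]
  · refine Finset.prod_congr rfl fun o' h => ?_
    simp [comp_unit, Finset.ne_of_mem_erase h]

lemma exists_eq_add_unit {d : ℕ} {k : MI d} {o : Dir d} (h : k.comp o ≠ 0) :
    ∃ l, k = l + unit o := by
  cases o with
  | none =>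
    refine ⟨(k.1, k.2 - 1), comp_injective (funext fun o => ?_)⟩
    change k.2 ≠ 0 at h
    cases o <;> simp [comp, unit]
    omega
  | some ℓ =>
    refine ⟨(k.1 - Pi.single ℓ 1, k.2), comp_injective (funext fun o => ?_)⟩
    change k.1 ℓ ≠ 0 at h
    cases o with
    | none => simp [comp, unit]
    | some i =>
      by_cases hi : i = ℓ
      · subst hi; simp [comp, unit]; omega
      · simp [comp, unit, hi]

/-- Reindexing `k ↦ k + unit o` for summands that vanish where the component `o` does. -/
lemma sum_add_unit {d : ℕ} {E : Type*} [AddCommMonoid E] (o : Dir d) {s t : Finset (MI d)}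
    (hst : ∀ k, k ∈ s ↔ k + unit o ∈ t) (G : MI d → E) (hG : ∀ k, k.comp o = 0 → G k = 0) :
    ∑ k ∈ s, G (k + unit o) = ∑ k ∈ t, G k := by
  refine Finset.sum_bij_ne_zero (fun k _ _ => k + unit o) (fun k hk _ => (hst k).1 hk)
    (fun k _ _ l _ _ h => add_right_cancel h) (fun k hk h0 => ?_) (fun _ _ _ => rfl)
  obtain ⟨l, rfl⟩ := exists_eq_add_unit (fun h => h0 (hG k h))
  exact ⟨l, (hst l).2 hk, h0, rfl⟩

end MI

lemma mem_MIall {d p : ℕ} {j : MI d} : j ∈ MIall d p ↔ ∀ o, j.comp o ≤ p := by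
  simp only [MIall, Finset.mem_image, Finset.mem_univ, true_and]
  constructor
  · rintro ⟨a, rfl⟩ (_ | ℓ)
    · exact Nat.lt_succ_iff.1 a.2.2
    · exact Nat.lt_succ_iff.1 (a.1 ℓ).2
  · intro h
    exact ⟨(fun ℓ => ⟨j.1 ℓ, Nat.lt_succ_iff.2 (h (some ℓ))⟩,
      ⟨j.2, Nat.lt_succ_iff.2 (h none)⟩), rfl⟩

@[simp] lemma mem_MIeq {d m : ℕ} {j : MI d} : j ∈ MIeq d m ↔ j.deg = m := by
  simp only [MIeq, Finset.mem_filter, mem_MIall, and_iff_right_iff_imp]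
  rintro rfl o
  exact j.comp_le_deg o

@[simp] lemma mem_MIlt {d m : ℕ} {j : MI d} : j ∈ MIlt d m ↔ j.deg < m := by
  simp only [MIlt, Finset.mem_filter, mem_MIall, and_iff_right_iff_imp]
  exact fun h o => (j.comp_le_deg o).trans h.le

lemma sum_MIlt {d m : ℕ} {E : Type*} [AddCommMonoid E] (G : MI d → E) :
    ∑ k ∈ MIlt d m, G k = ∑ i ∈ Finset.range m, ∑ k ∈ MIeq d i, G k := by
  rw [← Finset.sum_fiberwise_of_maps_to (s := MIlt d m) (t := Finset.range m) (g := MI.deg)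
    (fun k hk => Finset.mem_range.2 (mem_MIlt.1 hk))]
  refine Finset.sum_congr rfl fun i hi => Finset.sum_congr ?_ fun _ _ => rfl
  ext k
  have := Finset.mem_range.1 hi
  simp only [Finset.mem_filter, mem_MIlt, mem_MIeq]
  omega

namespace MI

lemma sum_MIeq_succ {d i : ℕ} {K : Type*} [Field K] [CharZero K] (u : Dir d → K) (A : MI d → K) :
    ∑ k ∈ MIeq d i, (k.fact : K)⁻¹ * pow u k * ∑ o, u o * A (k + unit o) =
      (i + 1) * ∑ k ∈ MIeq d (i + 1), (k.fact : K)⁻¹ * pow u k * A k := by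
  have key (o : Dir d) : ∑ k ∈ MIeq d i, (k.fact : K)⁻¹ * pow u k * (u o * A (k + unit o)) =
      ∑ k ∈ MIeq d (i + 1), (k.comp o : K) * ((k.fact : K)⁻¹ * pow u k * A k) := by
    rw [← sum_add_unit o (s := MIeq d i) (t := MIeq d (i + 1)) (by simp [deg_add])
      (fun k => (k.comp o : K) * ((k.fact : K)⁻¹ * pow u k * A k)) (fun k h => by simp [h])]
    refine Finset.sum_congr rfl fun k _ => ?_
    have h1 : ((k + unit o).comp o : K) ≠ 0 := by
      rw [comp_add, comp_unit]; simp; norm_cast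
    have h2 : (k.fact : K) ≠ 0 := by exact_mod_cast k.fact_pos.ne'
    rw [fact_add_unit, pow_add_unit, Nat.cast_mul]
    field_simp
  simp_rw [Finset.mul_sum]
  rw [Finset.sum_comm]
  simp_rw [key]
  rw [Finset.sum_comm]
  refine Finset.sum_congr rfl fun k hk => ?_
  rw [← Finset.sum_mul, ← Nat.cast_sum, ← deg_eq, mem_MIeq.1 hk]
  push_cast
  ring

lemma MIeq_zero {d : ℕ} : MIeq d 0 = {0} := by
  ext k
  simp only [mem_MIeq, Finset.mem_singleton]
  exact ⟨eq_zero_of_deg_eq_zero, fun h => by simp [h]⟩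

/-- The multinomial theorem. -/
lemma sum_MIeq_pow {d : ℕ} {K : Type*} [Field K] [CharZero K] (u : Dir d → K) (i : ℕ) :
    ∑ k ∈ MIeq d i, (k.fact : K)⁻¹ * pow u k = (∑ o, u o) ^ i / i.factorial := by
  induction i with
  | zero => simp [MIeq_zero]
  | succ i ih =>
    have h := sum_MIeq_succ (i := i) u (fun _ => 1)
    simp only [mul_one] at h
    rw [← Finset.sum_mul, ih] at h
    have h1 : (i + 1 : K) ≠ 0 := by norm_cast
    have h2 : (i.factorial : K) ≠ 0 := by exact_mod_cast i.factorial_ne_zero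
    rw [← mul_right_inj' h1, ← h, Nat.factorial_succ]
    push_cast
    field_simp
    rw [pow_succ]

lemma inv_fact_le {d i : ℕ} {k : MI d} (hk : k ∈ MIeq d i) :
    (k.fact : ℝ)⁻¹ ≤ (d + 1 : ℝ) ^ i / i.factorial := by
  have h := sum_MIeq_pow (d := d) (fun _ => (1 : ℝ)) i
  simp only [pow, one_pow, Finset.prod_const_one, mul_one, Finset.sum_const, Finset.card_univ,
    Fintype.card_option, Fintype.card_fin, nsmul_eq_mul] at h
  push_cast at h
  rw [← h]
  exact Finset.single_le_sum (f := fun k : MI d => (k.fact : ℝ)⁻¹) (fun _ _ => by positivity) hk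

end MI

lemma card_MIeq_le (d s : ℕ) : (MIeq d s).card ≤ (d + s).choose d := by
  have h : (MIeq d s).card ≤ (Finset.finsuppAntidiag (Finset.univ : Finset (Dir d)) s).card := by
    refine Finset.card_le_card_of_injOn (fun k => Finsupp.equivFunOnFinite.symm k.comp)
      (fun k hk => ?_) (Finsupp.equivFunOnFinite.symm.injective.comp MI.comp_injective).injOn
    rw [Finset.mem_coe, mem_MIeq, MI.deg_eq] at hk
    simp [Finset.mem_finsuppAntidiag, hk]
  refine h.trans (le_of_eq ?_)
  rw [Finset.card_finsuppAntidiag_nat_eq_choose]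
  simp only [Finset.card_univ, Fintype.card_option, Fintype.card_fin]
  rw [show d + 1 + s - 1 = s + d by omega, add_comm d s, Nat.choose_symm_add]

/-- The unit vector of a coordinate direction. -/
def dirVec {d : ℕ} : Dir d → Pt d
  | none => tDir d
  | some ℓ => eDir d ℓ

/-- The coordinate of a point in a coordinate direction. -/
def coord {d : ℕ} (z : Pt d) : Dir d → ℝ
  | none => z.2
  | some ℓ => z.1 ℓ

lemma coord_dirVec {d : ℕ} (o o' : Dir d) : coord (dirVec o) o' = if o' = o then 1 else 0 := by
  cases o <;> cases o' <;> simp [coord, dirVec, tDir, eDir, eVecd]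

@[simp] lemma coord_add {d : ℕ} (z w : Pt d) (o : Dir d) :
    coord (z + w) o = coord z o + coord w o := by
  cases o <;> rfl

@[simp] lemma coord_smul {d : ℕ} (a : ℝ) (z : Pt d) (o : Dir d) :
    coord (a • z) o = a * coord z o := by
  cases o <;> rfl

lemma coord_injective {d : ℕ} : Function.Injective (coord (d := d)) := fun _ _ h =>
  Prod.ext (funext fun ℓ => congrFun h (some ℓ)) (congrFun h none)

lemma sum_coord_smul_dirVec {d : ℕ} (z : Pt d) : ∑ o, coord z o • dirVec o = z := by
  refine coord_injective (funext fun o' => ?_)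
  have h : ∀ s : Finset (Dir d), coord (∑ o ∈ s, coord z o • dirVec o) o' =
      ∑ o ∈ s, coord z o * coord (dirVec o) o' := by
    intro s
    induction s using Finset.induction_on with
    | empty => cases o' <;> simp [coord]
    | insert a s ha ih => rw [Finset.sum_insert ha, Finset.sum_insert ha, coord_add, coord_smul, ih]
  rw [h]
  simp [coord_dirVec]

lemma eDist_sq {d : ℕ} (z w : Pt d) : eDist z w ^ 2 = ∑ o, coord (z - w) o ^ 2 := by
  rw [eDist, Real.sq_sqrt (by positivity), Fintype.sum_option, add_comm]
  rfl

lemma eDist_nonneg {d : ℕ} (z w : Pt d) : 0 ≤ eDist z w := Real.sqrt_nonneg _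

lemma eDist_of_sub_eq_smul {d : ℕ} {z w z' w' : Pt d} {a : ℝ} (ha : 0 ≤ a)
    (h : z' - w' = a • (z - w)) : eDist z' w' = a * eDist z w := by
  rw [← sq_eq_sq₀ (eDist_nonneg _ _) (mul_nonneg ha (eDist_nonneg _ _)), mul_pow, eDist_sq,
    eDist_sq, h, Finset.mul_sum]
  simp [mul_pow]

lemma continuous_eDist {d : ℕ} (w : Pt d) : Continuous fun z => eDist z w := by
  unfold eDist; fun_prop

lemma fderiv_apply_eq_sum_pd {d : ℕ} (f : Pt d → ℂ) (z v : Pt d) :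
    fderiv ℝ f z v = ∑ o, (coord v o : ℂ) * pd (dirVec o) f z := by
  conv_lhs => rw [← sum_coord_smul_dirVec v]
  simp [pd, map_sum]

lemma ContDiffOn.pd {d n : ℕ} {U : Set (Pt d)} (hU : IsOpen U) {f : Pt d → ℂ} (v : Pt d)
    (hf : ContDiffOn ℝ (n + 1 : ℕ) f U) : ContDiffOn ℝ n (pd v f) U :=
  (hf.fderiv_of_isOpen hU (by norm_cast)).clm_apply contDiffOn_const

lemma pd_congr {d : ℕ} {U : Set (Pt d)} (hU : IsOpen U) {f g : Pt d → ℂ} (v : Pt d)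
    (h : Set.EqOn f g U) : Set.EqOn (pd v f) (pd v g) U := fun z hz => by
  rw [pd, pd, (h.eventuallyEq_of_mem (hU.mem_nhds hz)).fderiv_eq]

lemma pd_comm {d : ℕ} {U : Set (Pt d)} (hU : IsOpen U) {f : Pt d → ℂ} (v w : Pt d)
    (hf : ContDiffOn ℝ 2 f U) : Set.EqOn (pd v (pd w f)) (pd w (pd v f)) U := fun z hz => by
  have hd : DifferentiableAt ℝ (fderiv ℝ f) z :=
    ((hf.fderiv_of_isOpen hU (m := 1) (by norm_num)).contDiffAt (hU.mem_nhds hz)).differentiableAt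
      one_ne_zero
  have key (a b : Pt d) : pd a (pd b f) z = fderiv ℝ (fderiv ℝ f) z a b := by
    change fderiv ℝ (fun y => fderiv ℝ f y b) z a = _
    rw [fderiv_clm_apply hd (differentiableAt_const b)]
    simp
  rw [key, key]
  exact ((hf.contDiffAt (hU.mem_nhds hz)).isSymmSndFDerivAt (by simp)).eq v w

/-- The iterated partial derivative along a list of coordinate directions. -/
def Dlist {d : ℕ} (L : List (Dir d)) (f : Pt d → ℂ) : Pt d → ℂ :=
  L.foldr (fun o g => pd (dirVec o) g) f

@[simp] lemma Dlist_nil {d : ℕ} (f : Pt d → ℂ) : Dlist [] f = f := rfl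

@[simp] lemma Dlist_cons {d : ℕ} (o : Dir d) (L : List (Dir d)) (f : Pt d → ℂ) :
    Dlist (o :: L) f = pd (dirVec o) (Dlist L f) := rfl

lemma ContDiffOn.dlist {d n : ℕ} {U : Set (Pt d)} (hU : IsOpen U) {f : Pt d → ℂ}
    (L : List (Dir d)) (hf : ContDiffOn ℝ (n + L.length : ℕ) f U) :
    ContDiffOn ℝ n (Dlist L f) U := by
  induction L generalizing n with
  | nil => simpa using hf
  | cons o L ih =>
    refine ContDiffOn.pd hU _ (ih ?_)
    simpa [add_assoc, add_comm 1] using hf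

lemma Dlist_perm {d n : ℕ} {U : Set (Pt d)} (hU : IsOpen U) {f : Pt d → ℂ} {L L' : List (Dir d)}
    (h : L.Perm L') (hn : L.length ≤ n) (hf : ContDiffOn ℝ n f U) :
    Set.EqOn (Dlist L f) (Dlist L' f) U := by
  induction h with
  | nil => exact fun _ _ => rfl
  | cons o _ ih =>
    rw [List.length_cons] at hn
    exact pd_congr hU _ (ih (by omega))
  | swap o o' L =>
    rw [List.length_cons, List.length_cons] at hn
    exact pd_comm hU _ _ (ContDiffOn.dlist hU (n := 2) L (hf.of_le (by norm_cast; omega)))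
  | trans h1 _ ih1 ih2 => exact (ih1 hn).trans (ih2 (h1.length_eq ▸ hn))

namespace MI

/-- The list of coordinate directions underlying `Dmi j`. -/
def toList {d : ℕ} (j : MI d) : List (Dir d) :=
  (List.finRange d).flatMap (fun ℓ => List.replicate (j.1 ℓ) (some ℓ)) ++ List.replicate j.2 none

lemma count_toList {d : ℕ} (j : MI d) (o : Dir d) : j.toList.count o = j.comp o := by
  cases o with
  | none => simp [toList, comp, List.count_flatMap, List.count_replicate, Function.comp_def]
  | some ℓ =>
    simp [toList, comp, List.count_flatMap, List.count_replicate, Function.comp_def]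
    simp [← Fin.sum_univ_def]

lemma length_toList {d : ℕ} (j : MI d) : j.toList.length = j.deg := by
  simp [toList, deg, List.length_flatMap, List.finRange, List.map_ofFn, List.sum_ofFn]

lemma toList_add_unit_perm {d : ℕ} (j : MI d) (o : Dir d) :
    (o :: j.toList).Perm (j + unit o).toList := by
  rw [List.perm_iff_count]
  intro o'
  rw [List.count_cons, count_toList, count_toList, comp_add, comp_unit]
  simp [eq_comm (a := o)]

lemma sum_unit_toList {d : ℕ} (j : MI d) : (j.toList.map unit).sum = j := by
  refine comp_injective (funext fun o => ?_)
  have h : ∀ L : List (Dir d), (L.map unit).sum.comp o = L.count o := by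
    intro L
    induction L with
    | nil => simp
    | cons a L ih => simp [ih, comp_unit, List.count_cons, add_comm, eq_comm (a := o)]
  rw [h, count_toList]

end MI

lemma Dmi_eq_Dlist {d : ℕ} (j : MI d) (f : Pt d → ℂ) : Dmi j f = Dlist j.toList f := by
  have h1 (n : ℕ) (o : Dir d) (g : Pt d → ℂ) :
      Dlist (List.replicate n o) g = (pd (dirVec o))^[n] g := by
    induction n with
    | zero => rfl
    | succ n ih => rw [List.replicate_succ, Dlist_cons, ih, Function.iterate_succ_apply']
  have h2 (L L' : List (Dir d)) : Dlist (L ++ L') f = Dlist L (Dlist L' f) := List.foldr_append ..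
  have h2' (g) (L L' : List (Dir d)) : Dlist (L ++ L') g = Dlist L (Dlist L' g) :=
    List.foldr_append ..
  rw [MI.toList, h2, h1, Dmi]
  induction List.finRange d with
  | nil => rfl
  | cons ℓ l ih => rw [List.foldr_cons, ih, List.flatMap_cons, h2', h1]; rfl

section Dmi

variable {d m : ℕ} {U : Set (Pt d)} {φ : Pt d → ℂ}

lemma ContDiffOn.dmi (hU : IsOpen U) (hφ : ContDiffOn ℝ m φ U) {n : ℕ} {k : MI d}
    (hk : n + k.deg ≤ m) : ContDiffOn ℝ n (Dmi k φ) U := by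
  rw [Dmi_eq_Dlist]
  refine ContDiffOn.dlist hU _ (hφ.of_le ?_)
  rw [MI.length_toList]
  exact_mod_cast hk

lemma continuousOn_Dmi (hU : IsOpen U) (hφ : ContDiffOn ℝ m φ U) {k : MI d}
    (hk : k.deg ≤ m) : ContinuousOn (Dmi k φ) U :=
  (hφ.dmi hU (n := 0) (by omega)).continuousOn

lemma differentiableAt_Dmi (hU : IsOpen U) (hφ : ContDiffOn ℝ m φ U) {k : MI d}
    (hk : k.deg < m) {z : Pt d} (hz : z ∈ U) : DifferentiableAt ℝ (Dmi k φ) z :=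
  ((hφ.dmi hU (n := 1) (by omega)).contDiffAt (hU.mem_nhds hz)).differentiableAt (by simp)

lemma pd_Dmi (hU : IsOpen U) (hφ : ContDiffOn ℝ m φ U) {k : MI d}
    (hk : k.deg < m) (o : Dir d) :
    Set.EqOn (pd (dirVec o) (Dmi k φ)) (Dmi (k + MI.unit o) φ) U := by
  rw [Dmi_eq_Dlist, Dmi_eq_Dlist, ← Dlist_cons]
  refine Dlist_perm hU (k.toList_add_unit_perm o) ?_ hφ
  rw [List.length_cons, MI.length_toList]
  omega

end Dmi

/-- The complex valued monomial function `z ^ k`. -/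
def monom {d : ℕ} (k : MI d) (z : Pt d) : ℂ := MI.pow (fun o => (coord z o : ℂ)) k

lemma monoC_one {d : ℕ} (c : Pt d) (k : MI d) (z : Pt d) : monoC c 1 k z = monom k (z - c) := by
  simp [monoC, monom, MI.pow, Fintype.prod_option, MI.comp, coord, mul_comm]

lemma contDiff_coord {d : ℕ} {n : WithTop ℕ∞} (o : Dir d) :
    ContDiff ℝ n (fun z : Pt d => coord z o) := by
  cases o <;> simp only [coord] <;> fun_prop

lemma contDiff_monom {d : ℕ} {n : WithTop ℕ∞} (k : MI d) : ContDiff ℝ n (monom k) := by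
  unfold monom MI.pow
  exact contDiff_prod fun o _ => (Complex.ofRealCLM.contDiff.comp (contDiff_coord o)).pow _

lemma pd_monom {d : ℕ} (k : MI d) (o : Dir d) (z : Pt d) : pd (dirVec o) (monom k) z =
    k.comp o * (coord z o : ℂ) ^ (k.comp o - 1) *
      ∏ o' ∈ Finset.univ.erase o, (coord z o' : ℂ) ^ k.comp o' := by
  rw [pd, ← ((contDiff_monom (n := 1) k).differentiable one_ne_zero z).lineDeriv_eq_fderiv,
    lineDeriv]
  have h : (fun t : ℝ => monom k (z + t • dirVec o)) = fun t : ℝ =>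
      ((coord z o : ℂ) + t) ^ k.comp o *
        ∏ o' ∈ Finset.univ.erase o, (coord z o' : ℂ) ^ k.comp o' := by
    funext t
    rw [monom, MI.pow, ← Finset.mul_prod_erase _ _ (Finset.mem_univ o)]
    congr 1
    · simp [coord_dirVec]
    · refine Finset.prod_congr rfl fun o' h => ?_
      simp [coord_dirVec, Finset.ne_of_mem_erase h]
  rw [h]
  have h2 : HasDerivAt (fun t : ℝ => (coord z o : ℂ) + t) 1 0 :=
    (Complex.ofRealCLM.hasDerivAt (x := (0 : ℝ))).const_add _
  simpa using ((h2.fun_pow (k.comp o)).mul_const _).deriv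

lemma pd_monom_of_comp_eq_zero {d : ℕ} {k : MI d} {o : Dir d} (h : k.comp o = 0) (z : Pt d) :
    pd (dirVec o) (monom k) z = 0 := by
  simp [pd_monom, h]

lemma pd_monom_add_unit {d : ℕ} (k : MI d) (o : Dir d) (z : Pt d) :
    pd (dirVec o) (monom (k + MI.unit o)) z = (k + MI.unit o).comp o * monom k z := by
  rw [pd_monom, monom, MI.pow, ← Finset.mul_prod_erase _ _ (Finset.mem_univ o), mul_assoc]
  congr 2
  · simp [MI.comp_unit]
  · refine Finset.prod_congr rfl fun o' h => ?_
    simp [MI.comp_unit, Finset.ne_of_mem_erase h]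

section Average

variable {d : ℕ} {B : Set (Pt d)}

lemma exists_norm_comp_sub_le (hB : Bornology.IsBounded B) {F : Type*} [NormedAddCommGroup F]
    {g : Pt d → F} (hg : Continuous g) (z : Pt d) :
    ∃ C, ∀ w ∈ Metric.ball z 1, ∀ c ∈ B, ‖g (w - c)‖ ≤ C := by
  obtain ⟨R, hR⟩ := hB.subset_closedBall 0
  obtain ⟨C, hC⟩ := (isCompact_closedBall (0 : Pt d) (‖z‖ + 1 + R)).exists_bound_of_continuousOn
    hg.continuousOn
  refine ⟨C, fun w hw c hc => hC _ ?_⟩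
  have h1 : ‖c‖ ≤ R := by simpa using hR hc
  have h2 : ‖w‖ ≤ ‖z‖ + 1 := by
    have := norm_le_norm_add_norm_sub' w z
    rw [Metric.mem_ball, dist_eq_norm] at hw
    linarith
  simpa using (norm_sub_le w c).trans (by linarith)

lemma IntegrableOn.smul_comp_sub (hB : Bornology.IsBounded B) (hBm : MeasurableSet B)
    {F : Type*} [NormedAddCommGroup F] [NormedSpace ℂ F] [NormedSpace ℝ F] [IsScalarTower ℝ ℂ F]
    [SecondCountableTopology F]
    {a : Pt d → ℂ} (ha : IntegrableOn a B) {g : Pt d → F} (hg : Continuous g) (z : Pt d) :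
    IntegrableOn (fun c => a c • g (z - c)) B := by
  obtain ⟨C, hC⟩ := exists_norm_comp_sub_le hB hg z
  refine Integrable.mono' (ha.norm.mul_const C)
    (ha.aestronglyMeasurable.smul
      (by fun_prop : Continuous fun c => g (z - c)).aestronglyMeasurable) ?_
  filter_upwards [ae_restrict_mem hBm] with c hc
  rw [norm_smul]
  exact mul_le_mul_of_nonneg_left (hC z (by simp) c hc) (norm_nonneg _)

lemma hasFDerivAt_integral_mul_comp_sub (hB : Bornology.IsBounded B) (hBm : MeasurableSet B)
    {a p : Pt d → ℂ} (ha : IntegrableOn a B) (hp : ContDiff ℝ 1 p) (z : Pt d) :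
    HasFDerivAt (fun z => ∫ c in B, a c * p (z - c)) (∫ c in B, a c • fderiv ℝ p (z - c)) z := by
  have hp' : Continuous (fderiv ℝ p) := hp.continuous_fderiv one_ne_zero
  obtain ⟨C, hC⟩ := exists_norm_comp_sub_le hB hp' z
  refine hasFDerivAt_integral_of_dominated_of_fderiv_le (bound := fun c => ‖a c‖ * C)
    (F' := fun z c => a c • fderiv ℝ p (z - c))
    (Metric.ball_mem_nhds z one_pos) ?_ ?_ ?_ ?_ ?_ ?_
  · exact Filter.Eventually.of_forall fun w =>
      (IntegrableOn.smul_comp_sub hB hBm ha hp.continuous w).aestronglyMeasurable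
  · exact IntegrableOn.smul_comp_sub hB hBm ha hp.continuous z
  · exact (IntegrableOn.smul_comp_sub hB hBm ha hp' z).aestronglyMeasurable
  · filter_upwards [ae_restrict_mem hBm] with c hc w hw
    rw [norm_smul]
    exact mul_le_mul_of_nonneg_left (hC w hw c hc) (norm_nonneg _)
  · exact ha.norm.mul_const C
  · refine Filter.Eventually.of_forall fun c w _ => ?_
    have h := (hp.differentiable one_ne_zero (w - c)).hasFDerivAt.comp w
      ((hasFDerivAt_id w).sub_const c)
    simpa using h.const_mul (a c)

lemma pd_integral_mul_comp_sub (hB : Bornology.IsBounded B) (hBm : MeasurableSet B)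
    {a p : Pt d → ℂ} (ha : IntegrableOn a B) (hp : ContDiff ℝ 1 p) (v z : Pt d) :
    pd v (fun z => ∫ c in B, a c * p (z - c)) z = ∫ c in B, a c * pd v p (z - c) := by
  rw [pd, (hasFDerivAt_integral_mul_comp_sub hB hBm ha hp z).fderiv,
    ContinuousLinearMap.integral_apply
      (IntegrableOn.smul_comp_sub hB hBm ha (hp.continuous_fderiv one_ne_zero) z)]
  rfl

/-- The Taylor polynomial of order `M` built from a family `A` of derivatives. -/
def taylorAt (M : ℕ) (A : MI d → Pt d → ℂ) (c z : Pt d) : ℂ :=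
  ∑ k ∈ MIlt d M, (k.fact : ℂ)⁻¹ * (A k c * monom k (z - c))

lemma TaylorP_eq (m : ℕ) (c : Pt d) (φ : Pt d → ℂ) (z : Pt d) :
    TaylorP m c φ z = taylorAt m (fun k => Dmi k φ) c z := by
  simp only [TaylorP, taylorAt, monoC_one, mul_assoc]

/-- The Taylor polynomial built from a family `A`, averaged over the set `B` of centers. -/
def avgTaylor (B : Set (Pt d)) (M : ℕ) (A : MI d → Pt d → ℂ) (z : Pt d) : ℂ :=
  (volume B).toReal⁻¹ • ∑ k ∈ MIlt d M, (k.fact : ℂ)⁻¹ * ∫ c in B, A k c * monom k (z - c)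

lemma integrableOn_taylorAt (hB : Bornology.IsBounded B) (hBm : MeasurableSet B) {M : ℕ}
    {A : MI d → Pt d → ℂ} (hA : ∀ k, k.deg < M → IntegrableOn (A k) B) (z : Pt d) :
    IntegrableOn (fun c => taylorAt M A c z) B :=
  integrable_finsetSum _ fun k hk => (IntegrableOn.smul_comp_sub hB hBm (hA k (mem_MIlt.1 hk))
    (contDiff_monom (n := 0) k).continuous z).const_mul _

lemma avgTaylor_eq (hB : Bornology.IsBounded B) (hBm : MeasurableSet B) {M : ℕ}
    {A : MI d → Pt d → ℂ} (hA : ∀ k, k.deg < M → IntegrableOn (A k) B) (z : Pt d) :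
    avgTaylor B M A z = (volume B).toReal⁻¹ • ∫ c in B, taylorAt M A c z := by
  simp only [avgTaylor, taylorAt]
  have h := integral_finsetSum (μ := volume.restrict B) (MIlt d M)
    (f := fun k c => (k.fact : ℂ)⁻¹ * (A k c * monom k (z - c))) fun k hk =>
    (IntegrableOn.smul_comp_sub hB hBm (hA k (mem_MIlt.1 hk))
      (contDiff_monom (n := 0) k).continuous z).const_mul _
  rw [h]
  simp_rw [integral_const_mul]

lemma differentiable_avgTaylor (hB : Bornology.IsBounded B) (hBm : MeasurableSet B) {M : ℕ}
    {A : MI d → Pt d → ℂ} (hA : ∀ k, k.deg < M → IntegrableOn (A k) B) :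
    Differentiable ℝ (avgTaylor B M A) := fun z =>
  (DifferentiableAt.fun_sum fun k hk => ((hasFDerivAt_integral_mul_comp_sub hB hBm
    (hA k (mem_MIlt.1 hk)) (contDiff_monom k) z).differentiableAt.const_mul _)).const_smul
      (volume B).toReal⁻¹

lemma pd_avgTaylor (hB : Bornology.IsBounded B) (hBm : MeasurableSet B) {M : ℕ}
    {A : MI d → Pt d → ℂ} (hA : ∀ k, k.deg < M + 1 → IntegrableOn (A k) B) (o : Dir d) :
    pd (dirVec o) (avgTaylor B (M + 1) A) = avgTaylor B M (fun k => A (k + MI.unit o)) := by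
  funext z
  have hd : ∀ k ∈ MIlt d (M + 1), DifferentiableAt ℝ
      (fun z => ∫ c in B, A k c * monom k (z - c)) z := fun k hk =>
    (hasFDerivAt_integral_mul_comp_sub hB hBm (hA k (mem_MIlt.1 hk))
      (contDiff_monom k) z).differentiableAt
  have h1 : pd (dirVec o) (avgTaylor B (M + 1) A) z = (volume B).toReal⁻¹ •
      ∑ k ∈ MIlt d (M + 1), (k.fact : ℂ)⁻¹ *
        ∫ c in B, A k c * pd (dirVec o) (monom k) (z - c) := by
    rw [pd]
    unfold avgTaylor
    rw [fderiv_fun_const_smul (DifferentiableAt.fun_sum fun k hk => (hd k hk).const_mul _),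
      fderiv_fun_sum fun k hk => (hd k hk).const_mul _]
    simp only [_root_.smul_apply, _root_.sum_apply]
    congr 1
    refine Finset.sum_congr rfl fun k hk => ?_
    rw [fderiv_const_mul (hd k hk), ← pd_integral_mul_comp_sub hB hBm (hA k (mem_MIlt.1 hk))
      (contDiff_monom k)]
    rfl
  rw [h1, avgTaylor, ← MI.sum_add_unit o (s := MIlt d M) (by simp [MI.deg_add])
    (fun k => (k.fact : ℂ)⁻¹ * ∫ c in B, A k c * pd (dirVec o) (monom k) (z - c))
    (fun k h => by simp [pd_monom_of_comp_eq_zero h])]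
  congr 1
  refine Finset.sum_congr rfl fun k _ => ?_
  have h2 : ((k + MI.unit o).comp o : ℂ) ≠ 0 := by
    rw [MI.comp_add, MI.comp_unit]; simp; norm_cast
  have h3 : (k.fact : ℂ) ≠ 0 := by exact_mod_cast k.fact_pos.ne'
  simp_rw [pd_monom_add_unit, mul_left_comm (A _ _)]
  rw [integral_const_mul, MI.fact_add_unit, Nat.cast_mul]
  field_simp

lemma Dlist_sub_avgTaylor {m : ℕ} {U : Set (Pt d)} (hU : IsOpen U) {φ : Pt d → ℂ}
    (hφ : ContDiffOn ℝ m φ U) (hB : Bornology.IsBounded B) (hBm : MeasurableSet B)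
    (hA : ∀ k : MI d, k.deg < m → IntegrableOn (Dmi k φ) B) (L : List (Dir d)) (M : ℕ)
    (hL : M + L.length = m) :
    Set.EqOn (Dlist L (fun z => φ z - avgTaylor B m (fun k => Dmi k φ) z))
      (fun z => Dmi (L.map MI.unit).sum φ z -
        avgTaylor B M (fun k => Dmi (k + (L.map MI.unit).sum) φ) z) U := by
  have hdeg : ∀ L : List (Dir d), (L.map MI.unit).sum.deg = L.length := by
    intro L
    induction L with
    | nil => simp
    | cons o L ih => simp [MI.deg_add, ih, add_comm]
  induction L generalizing M with
  | nil =>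
    subst hL
    intro z _
    have h0 : (0 : MI d).toList = [] :=
      List.eq_nil_of_length_eq_zero ((MI.length_toList 0).trans MI.deg_zero)
    simp [Dmi_eq_Dlist (0 : MI d), h0]
  | cons o L ih =>
    rw [List.length_cons] at hL
    refine (pd_congr hU _ (ih (M + 1) (by omega))).trans fun z hz => ?_
    have hA' : ∀ k : MI d, k.deg < M + 1 → IntegrableOn (Dmi (k + (L.map MI.unit).sum) φ) B :=
      fun k hk => hA _ (by rw [MI.deg_add, hdeg]; omega)
    have h1 := pd_avgTaylor hB hBm hA' o
    have h2 := pd_Dmi hU hφ (k := (L.map MI.unit).sum) (by rw [hdeg]; omega) o hz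
    have h3 : pd (dirVec o) (fun z => Dmi (L.map MI.unit).sum φ z -
        avgTaylor B (M + 1) (fun k => Dmi (k + (L.map MI.unit).sum) φ) z) z =
        pd (dirVec o) (Dmi (L.map MI.unit).sum φ) z -
        pd (dirVec o) (avgTaylor B (M + 1) (fun k => Dmi (k + (L.map MI.unit).sum) φ)) z := by
      rw [pd, fderiv_fun_sub (differentiableAt_Dmi hU hφ (by rw [hdeg]; omega) hz)
        (differentiable_avgTaylor hB hBm hA' z)]
      rfl
    rw [h3, h1, h2]
    simp only [List.map_cons, List.sum_cons, add_comm _ (MI.unit o), add_assoc,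
      add_left_comm _ (MI.unit o)]

lemma Dmi_sub_avgTaylor {m : ℕ} {U : Set (Pt d)} (hU : IsOpen U) {φ : Pt d → ℂ}
    (hφ : ContDiffOn ℝ m φ U) (hB : Bornology.IsBounded B) (hBm : MeasurableSet B)
    (hA : ∀ k : MI d, k.deg < m → IntegrableOn (Dmi k φ) B) (j : MI d) (hj : j.deg ≤ m) :
    Set.EqOn (Dmi j (fun z => φ z - avgTaylor B m (fun k => Dmi k φ) z))
      (fun z => Dmi j φ z - avgTaylor B (m - j.deg) (fun k => Dmi (k + j) φ) z) U := by
  have h := Dlist_sub_avgTaylor hU hφ hB hBm hA j.toList (m - j.deg)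
    (by rw [MI.length_toList]; omega)
  rw [j.sum_unit_toList] at h
  rwa [Dmi_eq_Dlist]

end Average

lemma sq_lintegral_le {α : Type*} [MeasurableSpace α] {μ : Measure α} {f : α → ENNReal}
    (hf : AEMeasurable f μ) : (∫⁻ a, f a ∂μ) ^ 2 ≤ μ Set.univ * ∫⁻ a, f a ^ 2 ∂μ := by
  have h := ENNReal.lintegral_mul_le_Lp_mul_Lq μ Real.HolderConjugate.two_two
    (aemeasurable_const (b := (1 : ENNReal))) hf
  simp only [Pi.mul_apply, one_mul, one_pow, lintegral_const, ENNReal.rpow_two] at h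
  calc (∫⁻ a, f a ∂μ) ^ 2
      ≤ (μ Set.univ ^ (1 / 2 : ℝ) * (∫⁻ a, f a ^ 2 ∂μ) ^ (1 / 2 : ℝ)) ^ 2 := by gcongr
    _ = μ Set.univ * ∫⁻ a, f a ^ 2 ∂μ := by
        rw [mul_pow, ← ENNReal.rpow_two, ← ENNReal.rpow_two, ← ENNReal.rpow_mul,
          ← ENNReal.rpow_mul]
        norm_num

section Taylor

variable {d m M : ℕ} {U : Set (Pt d)} {φ : Pt d → ℂ} {j : MI d} {c z : Pt d}

/-- The Taylor coefficient of order `i` of `t ↦ Dmi j φ (c + t • (z - c))`. -/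
def segCoeff (φ : Pt d → ℂ) (j : MI d) (c z : Pt d) (i : ℕ) (t : ℝ) : ℂ :=
  ∑ k ∈ MIeq d i, (k.fact : ℂ)⁻¹ * monom k (z - c) * Dmi (k + j) φ (c + t • (z - c))

lemma hasDerivAt_segCoeff (hU : IsOpen U) (hφ : ContDiffOn ℝ m φ U) {i : ℕ}
    (hi : i + j.deg < m) {t : ℝ} (ht : c + t • (z - c) ∈ U) :
    HasDerivAt (segCoeff φ j c z i) ((i + 1) * segCoeff φ j c z (i + 1) t) t := by
  have h1 : HasDerivAt (fun t : ℝ => c + t • (z - c)) (z - c) t := by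
    simpa using ((hasDerivAt_id t).smul_const (z - c)).const_add c
  have h2 (k : MI d) (hk : k ∈ MIeq d i) : HasDerivAt
      (fun t : ℝ => (k.fact : ℂ)⁻¹ * monom k (z - c) * Dmi (k + j) φ (c + t • (z - c)))
      ((k.fact : ℂ)⁻¹ * monom k (z - c) *
        ∑ o, (coord (z - c) o : ℂ) * Dmi (k + MI.unit o + j) φ (c + t • (z - c))) t := by
    have hlt : (k + j).deg < m := by rw [MI.deg_add, mem_MIeq.1 hk]; exact hi
    have h3 := ((differentiableAt_Dmi hU hφ hlt ht).hasFDerivAt.comp_hasDerivAt t h1).const_mul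
      ((k.fact : ℂ)⁻¹ * monom k (z - c))
    refine h3.congr_deriv ?_
    rw [fderiv_apply_eq_sum_pd]
    congr 1
    refine Finset.sum_congr rfl fun o _ => ?_
    rw [pd_Dmi hU hφ hlt o ht, add_right_comm]
  have h3 := HasDerivAt.fun_sum h2
  have h4 := MI.sum_MIeq_succ (i := i) (fun o => (coord (z - c) o : ℂ))
    (fun k => Dmi (k + j) φ (c + t • (z - c)))
  change ∑ k ∈ MIeq d i, (k.fact : ℂ)⁻¹ * monom k (z - c) *
    ∑ o, (coord (z - c) o : ℂ) * Dmi (k + MI.unit o + j) φ (c + t • (z - c)) = _ at h4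
  rw [h4] at h3
  exact h3

lemma continuousOn_segCoeff (hU : IsOpen U) (hφ : ContDiffOn ℝ m φ U) {i : ℕ}
    (hi : i + j.deg ≤ m) (hseg : ∀ t ∈ Set.Icc (0 : ℝ) 1, c + t • (z - c) ∈ U) :
    ContinuousOn (segCoeff φ j c z i) (Set.Icc 0 1) := by
  refine continuousOn_finsetSum _ fun k hk => continuousOn_const.mul ?_
  refine (continuousOn_Dmi hU hφ ?_).comp (by fun_prop) hseg
  rw [MI.deg_add, mem_MIeq.1 hk]
  exact hi

lemma sub_taylorAt_eq_integral (hU : IsOpen U) (hφ : ContDiffOn ℝ m φ U)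
    (hM : M + j.deg = m) (hM0 : M ≠ 0) (hseg : ∀ t ∈ Set.Icc (0 : ℝ) 1, c + t • (z - c) ∈ U) :
    Dmi j φ z - taylorAt M (fun k => Dmi (k + j) φ) c z =
      ∫ t in (0 : ℝ)..1, (M : ℂ) * (1 - t : ℂ) ^ (M - 1) * segCoeff φ j c z M t := by
  have hderiv : ∀ t ∈ Set.uIcc (0 : ℝ) 1, HasDerivAt
      (fun t : ℝ => ∑ i ∈ Finset.range M, (1 - t : ℂ) ^ i * segCoeff φ j c z i t)
      ((M : ℂ) * (1 - t : ℂ) ^ (M - 1) * segCoeff φ j c z M t) t := by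
    intro t ht
    rw [Set.uIcc_of_le zero_le_one] at ht
    have h1 : HasDerivAt (fun t : ℝ => (1 - t : ℂ)) (-1) t :=
      (Complex.ofRealCLM.hasDerivAt (x := t)).const_sub 1
    have h2 := HasDerivAt.fun_sum (u := Finset.range M) fun i hi =>
      (h1.fun_pow i).fun_mul (hasDerivAt_segCoeff (i := i) (j := j) hU hφ
        (by have := Finset.mem_range.1 hi; omega) (hseg t ht))
    refine h2.congr_deriv ?_
    have h3 := Finset.sum_range_sub
      (fun i => (i : ℂ) * (1 - t : ℂ) ^ (i - 1) * segCoeff φ j c z i t) M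
    simp only [Nat.cast_zero, zero_mul, sub_zero] at h3
    rw [← h3]
    refine Finset.sum_congr rfl fun i _ => ?_
    simp only [Nat.add_sub_cancel]
    push_cast
    ring
  rw [intervalIntegral.integral_eq_sub_of_hasDerivAt hderiv]
  · congr 1
    · obtain ⟨n, rfl⟩ := Nat.exists_eq_succ_of_ne_zero hM0
      rw [Finset.sum_range_succ']
      simp [segCoeff, MI.MIeq_zero, monom]
    · rw [taylorAt, sum_MIlt]
      refine Finset.sum_congr rfl fun i _ => ?_
      simp only [segCoeff, Complex.ofReal_zero, sub_zero, one_pow, one_mul, zero_smul, add_zero]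
      exact Finset.sum_congr rfl fun k _ => by ring
  · refine ContinuousOn.intervalIntegrable ?_
    rw [Set.uIcc_of_le zero_le_one]
    exact (by fun_prop : Continuous fun t : ℝ => (M : ℂ) * (1 - t : ℂ) ^ (M - 1)).continuousOn.mul
      (continuousOn_segCoeff hU hφ hM.le hseg)

lemma norm_segCoeff_sq_le {i : ℕ} {h : ℝ} (hcz : eDist z c ≤ h) (t : ℝ) :
    ‖segCoeff φ j c z i t‖ ^ 2 ≤ (h ^ i / i.factorial) ^ 2 * (d + 1 : ℝ) ^ i *
      ∑ k ∈ MIeq d i, ‖Dmi (k + j) φ (c + t • (z - c))‖ ^ 2 := by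
  set y := c + t • (z - c)
  have h1 : ‖segCoeff φ j c z i t‖ ≤
      ∑ k ∈ MIeq d i, (k.fact : ℝ)⁻¹ * ‖monom k (z - c)‖ * ‖Dmi (k + j) φ y‖ :=
    (norm_sum_le _ _).trans (le_of_eq (by simp [y]))
  have h2 : (∑ k ∈ MIeq d i, (k.fact : ℝ)⁻¹ * ‖monom k (z - c)‖ * ‖Dmi (k + j) φ y‖) ^ 2 ≤
      (∑ k ∈ MIeq d i, (k.fact : ℝ)⁻¹ * MI.pow (fun o => coord (z - c) o ^ 2) k) *
        ∑ k ∈ MIeq d i, (k.fact : ℝ)⁻¹ * ‖Dmi (k + j) φ y‖ ^ 2 := by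
    refine Finset.sum_sq_le_sum_mul_sum_of_sq_le_mul _ (fun k _ => ?_) (fun k _ => by positivity)
      fun k _ => ?_
    · unfold MI.pow; positivity
    · refine le_of_eq ?_
      have : ‖monom k (z - c)‖ ^ 2 = MI.pow (fun o => coord (z - c) o ^ 2) k := by
        simp only [monom, MI.pow, norm_prod, norm_pow, Complex.norm_real, Real.norm_eq_abs,
          ← Finset.prod_pow]
        refine Finset.prod_congr rfl fun o _ => ?_
        rw [← pow_mul, mul_comm, pow_mul, sq_abs]
      rw [← this]
      ring
  have h3 : ∑ k ∈ MIeq d i, (k.fact : ℝ)⁻¹ * MI.pow (fun o => coord (z - c) o ^ 2) k ≤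
      (h ^ i) ^ 2 / i.factorial := by
    rw [MI.sum_MIeq_pow, ← eDist_sq, ← pow_mul, ← pow_mul, mul_comm 2]
    have := eDist_nonneg z c
    gcongr
  have h4 : ∑ k ∈ MIeq d i, (k.fact : ℝ)⁻¹ * ‖Dmi (k + j) φ y‖ ^ 2 ≤
      (d + 1 : ℝ) ^ i / i.factorial * ∑ k ∈ MIeq d i, ‖Dmi (k + j) φ y‖ ^ 2 := by
    rw [Finset.mul_sum]
    exact Finset.sum_le_sum fun k hk =>
      mul_le_mul_of_nonneg_right (MI.inv_fact_le hk) (by positivity)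
  calc _ ≤ _ := by gcongr
    _ ≤ _ := h2
    _ ≤ _ := mul_le_mul h3 h4 (Finset.sum_nonneg fun k _ => by positivity) (by positivity)
    _ = _ := by field_simp

lemma enorm_sub_taylorAt_sq_le (hU : IsOpen U) (hφ : ContDiffOn ℝ m φ U)
    (hM : M + j.deg = m) (hM0 : M ≠ 0) (hseg : ∀ t ∈ Set.Icc (0 : ℝ) 1, c + t • (z - c) ∈ U)
    {h : ℝ} (hcz : eDist z c ≤ h) :
    ‖Dmi j φ z - taylorAt M (fun k => Dmi (k + j) φ) c z‖ₑ ^ 2 ≤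
      ENNReal.ofReal ((h ^ M / (M - 1).factorial) ^ 2 * (d + 1 : ℝ) ^ M) *
        ∫⁻ t in Set.Ioc (0 : ℝ) 1,
          ∑ k ∈ MIeq d M, ‖Dmi (k + j) φ (c + t • (z - c))‖ₑ ^ 2 := by
  rw [sub_taylorAt_eq_integral hU hφ hM hM0 hseg, intervalIntegral.integral_of_le zero_le_one,
    ← lintegral_const_mul' _ _ ENNReal.ofReal_ne_top]
  have hcont : ContinuousOn (fun t : ℝ => (M : ℂ) * (1 - t : ℂ) ^ (M - 1) * segCoeff φ j c z M t)
      (Set.Ioc 0 1) :=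
    (by fun_prop : Continuous fun t : ℝ => (M : ℂ) * (1 - t : ℂ) ^ (M - 1)).continuousOn.mul
      ((continuousOn_segCoeff hU hφ hM.le hseg).mono Set.Ioc_subset_Icc_self)
  refine (pow_le_pow_left' (enorm_integral_le_lintegral_enorm _) 2).trans
    ((sq_lintegral_le (hcont.aestronglyMeasurable measurableSet_Ioc).enorm).trans ?_)
  simp only [Measure.restrict_apply MeasurableSet.univ, Set.univ_inter, Real.volume_Ioc, sub_zero,
    ENNReal.ofReal_one, one_mul]
  refine setLIntegral_mono' measurableSet_Ioc fun t ht => ?_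
  have h1 : ‖(M : ℂ) * (1 - t : ℂ) ^ (M - 1) * segCoeff φ j c z M t‖ ^ 2 ≤
      (h ^ M / (M - 1).factorial) ^ 2 * (d + 1 : ℝ) ^ M *
        ∑ k ∈ MIeq d M, ‖Dmi (k + j) φ (c + t • (z - c))‖ ^ 2 := by
    have h2 : ‖(1 - t : ℂ)‖ ≤ 1 := by
      rw [← Complex.ofReal_one, ← Complex.ofReal_sub, Complex.norm_real, Real.norm_eq_abs,
        abs_of_nonneg (by linarith [ht.2])]
      linarith [ht.1]
    have h3 : ‖(M : ℂ) * (1 - t : ℂ) ^ (M - 1) * segCoeff φ j c z M t‖ ≤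
        M * ‖segCoeff φ j c z M t‖ := by
      rw [norm_mul, norm_mul, norm_pow, Complex.norm_natCast]
      gcongr
      exact mul_le_of_le_one_right (Nat.cast_nonneg _) (pow_le_one₀ (norm_nonneg _) h2)
    have h4 : ((M.factorial : ℕ) : ℝ) = M * (M - 1).factorial := by
      exact_mod_cast (Nat.mul_factorial_pred hM0).symm
    have h5 : (M : ℝ) ≠ 0 := by exact_mod_cast hM0
    calc _ ≤ (M * ‖segCoeff φ j c z M t‖) ^ 2 := by gcongr
      _ = M ^ 2 * ‖segCoeff φ j c z M t‖ ^ 2 := by ring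
      _ ≤ M ^ 2 * ((h ^ M / M.factorial) ^ 2 * (d + 1 : ℝ) ^ M *
          ∑ k ∈ MIeq d M, ‖Dmi (k + j) φ (c + t • (z - c))‖ ^ 2) := by
        gcongr; exact norm_segCoeff_sq_le hcz t
      _ = _ := by rw [h4]; field_simp
  have h2 := ENNReal.ofReal_le_ofReal h1
  rw [ENNReal.ofReal_mul (by positivity),
    ENNReal.ofReal_sum_of_nonneg fun _ _ => by positivity] at h2
  simpa only [ENNReal.ofReal_pow (norm_nonneg _), ofReal_norm] using h2

end Taylor

section Measure

variable {d : ℕ}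

instance : (volume : Measure (Pt d)).IsAddHaarMeasure :=
  inferInstanceAs ((volume : Measure (Fin d → ℝ)).prod (volume : Measure ℝ)).IsAddHaarMeasure

lemma finrank_Pt : Module.finrank ℝ (Pt d) = d + 1 := by simp [Pt]

lemma lintegral_comp_smul_add {a : ℝ} (ha : 0 < a) (b : Pt d) {H : Pt d → ENNReal}
    (hH : Measurable H) :
    ∫⁻ z, H (a • z + b) = ENNReal.ofReal (a⁻¹ ^ (d + 1)) * ∫⁻ z, H z := by
  have h1 : ∫⁻ z, H (a • z + b) = ∫⁻ z, H (z + b) ∂(Measure.map (a • ·) volume) :=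
    (lintegral_map (f := fun z => H (z + b)) (by fun_prop) (by fun_prop)).symm
  rw [h1, Measure.map_addHaar_smul _ ha.ne', lintegral_smul_measure, lintegral_add_right_eq_self,
    finrank_Pt, abs_of_pos (by positivity), inv_pow, smul_eq_mul]

lemma lintegral_segment_le {B U : Set (Pt d)} {ρ : ℝ} (hρ0 : 0 < ρ) (hρ1 : ρ < 1)
    (hU : volume U ≤ ENNReal.ofReal (((1 - ρ) / ρ) ^ (d + 1)) * volume B)
    {H : Pt d → ENNReal} (hH : Measurable H) :
    ∫⁻ z in U, ∫⁻ c in B, ∫⁻ t in Set.Ioc (0 : ℝ) 1, H (c + t • (z - c)) ≤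
      volume B * ENNReal.ofReal (ρ⁻¹ ^ (d + 1)) * ∫⁻ z, H z := by
  have hbound : ∀ t ∈ Set.Ioc (0 : ℝ) 1, ∫⁻ z in U, ∫⁻ c in B, H (c + t • (z - c)) ≤
      volume B * ENNReal.ofReal (ρ⁻¹ ^ (d + 1)) * ∫⁻ z, H z := by
    intro t ht
    rcases le_or_gt ρ t with htρ | htρ
    · have hm : Measurable fun p : Pt d × Pt d => H (p.2 + t • (p.1 - p.2)) :=
        hH.comp (by fun_prop)
      rw [lintegral_lintegral_swap (f := fun z c => H (c + t • (z - c))) hm.aemeasurable]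
      calc ∫⁻ c in B, ∫⁻ z in U, H (c + t • (z - c))
          ≤ ∫⁻ c in B, ENNReal.ofReal (ρ⁻¹ ^ (d + 1)) * ∫⁻ z, H z := by
            refine lintegral_mono fun c => (setLIntegral_le_lintegral U _).trans ?_
            have h1 (z : Pt d) : c + t • (z - c) = t • z + (1 - t) • c := by module
            simp_rw [h1]
            rw [lintegral_comp_smul_add ht.1 _ hH]
            have ht0 : 0 ≤ t⁻¹ := inv_nonneg.2 ht.1.le
            gcongr
        _ = _ := by rw [setLIntegral_const]; ring
    · have h1t : 0 < 1 - t := by linarith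
      calc ∫⁻ z in U, ∫⁻ c in B, H (c + t • (z - c))
          ≤ ∫⁻ z in U, ENNReal.ofReal ((1 - t)⁻¹ ^ (d + 1)) * ∫⁻ z, H z := by
            refine lintegral_mono fun z => (setLIntegral_le_lintegral B _).trans ?_
            have h1 (c : Pt d) : c + t • (z - c) = (1 - t) • c + t • z := by module
            simp_rw [h1]
            rw [lintegral_comp_smul_add h1t _ hH]
        _ = volume U * (ENNReal.ofReal ((1 - t)⁻¹ ^ (d + 1)) * ∫⁻ z, H z) := by
            rw [setLIntegral_const]; ring
        _ ≤ ENNReal.ofReal (((1 - ρ) / ρ) ^ (d + 1)) * volume B *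
            (ENNReal.ofReal ((1 - t)⁻¹ ^ (d + 1)) * ∫⁻ z, H z) := by gcongr
        _ = volume B * ENNReal.ofReal (((1 - ρ) / ρ * (1 - t)⁻¹) ^ (d + 1)) * ∫⁻ z, H z := by
            have h1ρ : 0 ≤ (1 - ρ) / ρ := div_nonneg (by linarith) hρ0.le
            rw [mul_pow, ENNReal.ofReal_mul (by positivity)]
            ring
        _ ≤ _ := by
            have h1ρ : 0 ≤ (1 - ρ) / ρ := div_nonneg (by linarith) hρ0.le
            have h2 : (1 - ρ) / ρ * (1 - t)⁻¹ ≤ ρ⁻¹ := by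
              rw [div_mul_eq_mul_div, div_le_iff₀ hρ0, inv_mul_cancel₀ hρ0.ne', ← div_eq_mul_inv,
                div_le_one h1t]
              linarith
            gcongr
  calc ∫⁻ z in U, ∫⁻ c in B, ∫⁻ t in Set.Ioc (0 : ℝ) 1, H (c + t • (z - c))
      = ∫⁻ z in U, ∫⁻ t in Set.Ioc (0 : ℝ) 1, ∫⁻ c in B, H (c + t • (z - c)) := by
        refine lintegral_congr fun z => lintegral_lintegral_swap ?_
        exact (hH.comp (by fun_prop)).aemeasurable
    _ = ∫⁻ t in Set.Ioc (0 : ℝ) 1, ∫⁻ z in U, ∫⁻ c in B, H (c + t • (z - c)) := by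
        refine lintegral_lintegral_swap ?_
        have hm' : Measurable fun p : (Pt d × ℝ) × Pt d => H (p.2 + p.1.2 • (p.1.1 - p.2)) :=
          hH.comp (by fun_prop)
        exact hm'.lintegral_prod_right'.aemeasurable
    _ ≤ ∫⁻ t in Set.Ioc (0 : ℝ) 1, volume B * ENNReal.ofReal (ρ⁻¹ ^ (d + 1)) * ∫⁻ z, H z :=
        setLIntegral_mono' measurableSet_Ioc hbound
    _ = _ := by rw [setLIntegral_const]; simp

/-- The Euclidean open ball. -/
def eBall (c : Pt d) (r : ℝ) : Set (Pt d) := {w | eDist w c < r}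

lemma isOpen_eBall (c : Pt d) (r : ℝ) : IsOpen (eBall c r) :=
  isOpen_lt (continuous_eDist c) continuous_const

lemma volume_eBall_mul {a : ℝ} (ha : 0 < a) (c : Pt d) (r : ℝ) :
    volume (eBall c (a * r)) = ENNReal.ofReal (a ^ (d + 1)) * volume (eBall c r) := by
  have h := lintegral_comp_smul_add (inv_pos.2 ha) (c - a⁻¹ • c)
    (measurable_one.indicator (isOpen_eBall c r).measurableSet)
  rw [lintegral_indicator_one (isOpen_eBall c r).measurableSet, inv_inv] at h
  rw [← h, ← lintegral_indicator_one (isOpen_eBall c (a * r)).measurableSet]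
  refine lintegral_congr fun z => ?_
  have h1 : a⁻¹ • z + (c - a⁻¹ • c) ∈ eBall c r ↔ z ∈ eBall c (a * r) := by
    change eDist _ _ < _ ↔ eDist _ _ < _
    rw [eDist_of_sub_eq_smul (z := z) (w := c) (inv_pos.2 ha).le (by module), inv_mul_lt_iff₀ ha]
  by_cases hz : z ∈ eBall c (a * r)
  · rw [Set.indicator_of_mem hz, Set.indicator_of_mem (h1.2 hz)]; rfl
  · rw [Set.indicator_of_notMem hz, Set.indicator_of_notMem (mt h1.1 hz)]

/-- A set of diameter `h` containing a ball of radius `r` lies in the concentric ball of radius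
`h - r`. -/
lemma subset_eBall {U : Set (Pt d)} (hU : IsOpen U) {h r : ℝ} (hr : 0 < r)
    (hdiam : ∀ z ∈ U, ∀ w ∈ U, eDist z w ≤ h) (hrh : r < h) {c : Pt d} (hc : eBall c r ⊆ U) :
    U ⊆ eBall c (h - r) := by
  have key : ∀ z ∈ U, eDist z c ≤ h - r := by
    intro z hz
    rcases (eDist_nonneg z c).eq_or_lt with h0 | h0
    · rw [← h0]; linarith
    · by_contra! hlt
      obtain ⟨e, he, her⟩ : ∃ e, max 0 (h - eDist z c) < e ∧ e < r :=
        exists_between (max_lt hr (by linarith))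
      obtain ⟨he0, heh⟩ := max_lt_iff.1 he
      have hq : 0 ≤ e / eDist z c := by positivity
      have hsymm : eDist c z = eDist z c := by
        simp only [eDist]
        congr 2
        · exact Finset.sum_congr rfl fun _ _ => by ring
        · ring
      have hp : c - (e / eDist z c) • (z - c) ∈ eBall c r := by
        change eDist _ _ < _
        rwa [eDist_of_sub_eq_smul (z := c) (w := z) hq (by module), hsymm,
          div_mul_cancel₀ _ h0.ne']
      have h1 := hdiam z hz _ (hc hp)
      rw [eDist_of_sub_eq_smul (z := z) (w := c) (a := 1 + e / eDist z c) (by linarith)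
        (by module), add_mul, one_mul, div_mul_cancel₀ _ h0.ne'] at h1
      linarith
  intro z hz
  rcases (eDist_nonneg z c).eq_or_lt with h0 | h0
  · change eDist z c < h - r
    rw [← h0]; linarith
  have hcont : ContinuousAt (fun e : ℝ => z + e • (z - c)) 0 := by fun_prop
  have hev : ∀ᶠ e : ℝ in nhdsWithin 0 (Set.Ioi 0), z + e • (z - c) ∈ U :=
    nhdsWithin_le_nhds (hcont.eventually (hU.mem_nhds (by simpa using hz)))
  obtain ⟨e, heU, he⟩ := (hev.and self_mem_nhdsWithin).exists
  have he : 0 < e := he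
  have h1 := key _ heU
  rw [eDist_of_sub_eq_smul (z := z) (w := c) (a := 1 + e) (by linarith) (by module)] at h1
  change eDist z c < h - r
  nlinarith

lemma eDist_pos_of_isOpen {U : Set (Pt d)} (hU : IsOpen U) {h : ℝ}
    (hdiam : ∀ z ∈ U, ∀ w ∈ U, eDist z w ≤ h) (hne : U.Nonempty) : 0 < h := by
  obtain ⟨z, hz⟩ := hne
  have hcont : ContinuousAt (fun e : ℝ => z + e • tDir d) 0 := by fun_prop
  have hev : ∀ᶠ e : ℝ in nhdsWithin 0 (Set.Ioi 0), z + e • tDir d ∈ U :=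
    nhdsWithin_le_nhds (hcont.eventually (hU.mem_nhds (by simpa using hz)))
  obtain ⟨e, heU, he⟩ := (hev.and self_mem_nhdsWithin).exists
  have he : 0 < e := he
  have h1 := hdiam _ heU z hz
  rw [eDist_of_sub_eq_smul (z := tDir d) (w := 0) he.le (by module)] at h1
  have h2 : eDist (tDir d) 0 = 1 := by simp [eDist, tDir]
  rw [h2] at h1
  linarith

end Measure

section Remainder

variable {d : ℕ}

lemma integrableOn_Dmi {m : ℕ} {U B : Set (Pt d)} {φ : Pt d → ℂ} (hU : IsOpen U)
    (hφ : ContDiffOn ℝ m φ U) (hB : MeasurableSet B) (hBU : B ⊆ U) (hBfin : volume B ≠ ⊤)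
    {k : MI d} (hk : k.deg ≤ m) (hL2 : IntegrableOn (fun z => ‖Dmi k φ z‖ ^ 2) U) :
    IntegrableOn (Dmi k φ) B := by
  have : IsFiniteMeasure (volume.restrict B) := isFiniteMeasure_restrict.2 hBfin
  have h1 : AEStronglyMeasurable (Dmi k φ) (volume.restrict B) :=
    ((continuousOn_Dmi hU hφ hk).mono hBU).aestronglyMeasurable hB
  exact ((memLp_two_iff_integrable_sq_norm h1).2 (hL2.mono_set hBU)).integrable (by norm_num)

lemma enorm_sub_avgTaylor_sq_le {m M : ℕ} {U B : Set (Pt d)} {φ : Pt d → ℂ} {h : ℝ}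
    (hU : IsOpen U) (hφ : ContDiffOn ℝ m φ U) {j : MI d} (hM : M + j.deg = m) (hM0 : M ≠ 0)
    (hB : Bornology.IsBounded B) (hBm : MeasurableSet B) (hB0 : volume B ≠ 0)
    (hint : ∀ k : MI d, k.deg < M → IntegrableOn (Dmi (k + j) φ) B) {z : Pt d}
    (hseg : ∀ c ∈ B, ∀ t ∈ Set.Icc (0 : ℝ) 1, c + t • (z - c) ∈ U)
    (hcz : ∀ c ∈ B, eDist z c ≤ h) :
    ‖Dmi j φ z - avgTaylor B M (fun k => Dmi (k + j) φ) z‖ₑ ^ 2 ≤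
      (volume B)⁻¹ * (ENNReal.ofReal ((h ^ M / (M - 1).factorial) ^ 2 * (d + 1 : ℝ) ^ M) *
        ∫⁻ c in B, ∫⁻ t in Set.Ioc (0 : ℝ) 1,
          ∑ k ∈ MIeq d M, ‖Dmi (k + j) φ (c + t • (z - c))‖ₑ ^ 2) := by
  have hBfin : volume B ≠ ⊤ := hB.measure_lt_top.ne
  have hT := integrableOn_taylorAt hB hBm hint z
  have hconst : IntegrableOn (fun _ : Pt d => Dmi j φ z) B := integrableOn_const hBfin
  have hr0 : (volume B).toReal ≠ 0 := ENNReal.toReal_ne_zero.2 ⟨hB0, hBfin⟩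
  have hrep : Dmi j φ z - avgTaylor B M (fun k => Dmi (k + j) φ) z =
      (volume B).toReal⁻¹ •
        ∫ c in B, (Dmi j φ z - taylorAt M (fun k => Dmi (k + j) φ) c z) := by
    rw [avgTaylor_eq hB hBm hint, integral_sub hconst hT, setIntegral_const, smul_sub,
      Measure.real, inv_smul_smul₀ hr0]
  have hen : ‖(volume B).toReal⁻¹‖ₑ = (volume B)⁻¹ := by
    rw [← ofReal_norm, norm_inv, Real.norm_of_nonneg ENNReal.toReal_nonneg,
      ENNReal.ofReal_inv_of_pos (lt_of_le_of_ne ENNReal.toReal_nonneg hr0.symm),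
      ENNReal.ofReal_toReal hBfin]
  rw [hrep, enorm_smul, hen, mul_pow]
  have hmeas : AEMeasurable
      (fun c => ‖Dmi j φ z - taylorAt M (fun k => Dmi (k + j) φ) c z‖ₑ) (volume.restrict B) :=
    (hconst.sub hT).aestronglyMeasurable.enorm
  calc (volume B)⁻¹ ^ 2 *
        ‖∫ c in B, (Dmi j φ z - taylorAt M (fun k => Dmi (k + j) φ) c z)‖ₑ ^ 2
      ≤ (volume B)⁻¹ ^ 2 *
        (∫⁻ c in B, ‖Dmi j φ z - taylorAt M (fun k => Dmi (k + j) φ) c z‖ₑ) ^ 2 := by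
        gcongr
        exact enorm_integral_le_lintegral_enorm _
    _ ≤ (volume B)⁻¹ ^ 2 * (volume B *
        ∫⁻ c in B, ‖Dmi j φ z - taylorAt M (fun k => Dmi (k + j) φ) c z‖ₑ ^ 2) := by
        gcongr
        simpa using sq_lintegral_le hmeas
    _ = (volume B)⁻¹ *
        ∫⁻ c in B, ‖Dmi j φ z - taylorAt M (fun k => Dmi (k + j) φ) c z‖ₑ ^ 2 := by
        rw [← mul_assoc, sq, mul_assoc (volume B)⁻¹, ENNReal.inv_mul_cancel hB0 hBfin, mul_one]
    _ ≤ _ := by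
        gcongr
        rw [← lintegral_const_mul' _ _ ENNReal.ofReal_ne_top]
        refine setLIntegral_mono' hBm fun c hc => ?_
        exact enorm_sub_taylorAt_sq_le hU hφ hM hM0 (hseg c hc) (hcz c hc)

lemma lintegral_sub_avgTaylor_sq_le {m M : ℕ} {U B : Set (Pt d)} {φ : Pt d → ℂ} {h ρ : ℝ}
    (hU : IsOpen U) (hφ : ContDiffOn ℝ m φ U) {j : MI d} (hM : M + j.deg = m) (hM0 : M ≠ 0)
    (hB : Bornology.IsBounded B) (hBm : MeasurableSet B) (hB0 : volume B ≠ 0)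
    (hint : ∀ k : MI d, k.deg < M → IntegrableOn (Dmi (k + j) φ) B)
    (hstar : ∀ c ∈ B, ∀ z ∈ U, segment ℝ c z ⊆ U)
    (hdiam : ∀ z ∈ U, ∀ c ∈ B, eDist z c ≤ h) (hρ0 : 0 < ρ) (hρ1 : ρ < 1)
    (hvol : volume U ≤ ENNReal.ofReal (((1 - ρ) / ρ) ^ (d + 1)) * volume B) :
    ∫⁻ z in U, ‖Dmi j φ z - avgTaylor B M (fun k => Dmi (k + j) φ) z‖ₑ ^ 2 ≤
      ENNReal.ofReal ((h ^ M / (M - 1).factorial) ^ 2 * (d + 1 : ℝ) ^ M * ρ⁻¹ ^ (d + 1)) *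
        ∑ k ∈ MIeq d m, ∫⁻ z in U, ‖Dmi k φ z‖ₑ ^ 2 := by
  have hBfin : volume B ≠ ⊤ := hB.measure_lt_top.ne
  set K := ENNReal.ofReal ((h ^ M / (M - 1).factorial) ^ 2 * (d + 1 : ℝ) ^ M) with hK
  set H : Pt d → ENNReal :=
    fun w => ∑ k ∈ MIeq d M, U.indicator (fun w => ‖Dmi (k + j) φ w‖ₑ ^ 2) w with hH
  have hdeg {k : MI d} (hk : k ∈ MIeq d M) : (k + j).deg = m := by
    rw [MI.deg_add, mem_MIeq.1 hk, hM]
  have hmeas1 {k : MI d} (hk : k ∈ MIeq d M) :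
      Measurable (U.indicator fun w => ‖Dmi (k + j) φ w‖ₑ ^ 2) := by
    have h1 : ContinuousOn (fun w => ‖Dmi (k + j) φ w‖ₑ ^ 2) U :=
      (ENNReal.continuous_pow 2).comp_continuousOn
        (continuous_enorm.comp_continuousOn (continuousOn_Dmi hU hφ (hdeg hk).le))
    classical
    rw [← Set.piecewise_eq_indicator]
    exact h1.measurable_piecewise continuousOn_const hU.measurableSet
  have hHm : Measurable H := Finset.measurable_sum _ fun k hk => hmeas1 hk
  have hseg {z c : Pt d} (hz : z ∈ U) (hc : c ∈ B) {t : ℝ} (ht : t ∈ Set.Icc (0 : ℝ) 1) :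
      c + t • (z - c) ∈ U := by
    refine hstar c hc z hz ?_
    rw [segment_eq_image']
    exact ⟨t, ht, rfl⟩
  have hHeq {w : Pt d} (hw : w ∈ U) : H w = ∑ k ∈ MIeq d M, ‖Dmi (k + j) φ w‖ₑ ^ 2 :=
    Finset.sum_congr rfl fun k _ => Set.indicator_of_mem hw _
  calc ∫⁻ z in U, ‖Dmi j φ z - avgTaylor B M (fun k => Dmi (k + j) φ) z‖ₑ ^ 2
      ≤ ∫⁻ z in U, (volume B)⁻¹ * (K *
          ∫⁻ c in B, ∫⁻ t in Set.Ioc (0 : ℝ) 1, H (c + t • (z - c))) := by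
        refine setLIntegral_mono' hU.measurableSet fun z hz => ?_
        refine (enorm_sub_avgTaylor_sq_le hU hφ hM hM0 hB hBm hB0 hint
          (fun c hc t ht => hseg hz hc ht) (hdiam z hz)).trans_eq ?_
        congr 2
        refine setLIntegral_congr_fun hBm fun c hc =>
          setLIntegral_congr_fun measurableSet_Ioc fun t ht => ?_
        exact (hHeq (hseg hz hc (Set.Ioc_subset_Icc_self ht))).symm
    _ = (volume B)⁻¹ * (K *
          ∫⁻ z in U, ∫⁻ c in B, ∫⁻ t in Set.Ioc (0 : ℝ) 1, H (c + t • (z - c))) := by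
        rw [lintegral_const_mul' _ _ (ENNReal.inv_ne_top.2 hB0),
          lintegral_const_mul' _ _ ENNReal.ofReal_ne_top]
    _ ≤ (volume B)⁻¹ * (K * (volume B * ENNReal.ofReal (ρ⁻¹ ^ (d + 1)) * ∫⁻ z, H z)) := by
        gcongr
        exact lintegral_segment_le hρ0 hρ1 hvol hHm
    _ = ((volume B)⁻¹ * volume B) * (K * ENNReal.ofReal (ρ⁻¹ ^ (d + 1))) * ∫⁻ z, H z := by ring
    _ = ENNReal.ofReal ((h ^ M / (M - 1).factorial) ^ 2 * (d + 1 : ℝ) ^ M * ρ⁻¹ ^ (d + 1)) *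
          ∑ k ∈ MIeq d M, ∫⁻ z in U, ‖Dmi (k + j) φ z‖ₑ ^ 2 := by
        rw [ENNReal.inv_mul_cancel hB0 hBfin, one_mul, hK, ← ENNReal.ofReal_mul (by positivity),
          lintegral_finsetSum _ fun k hk => hmeas1 hk]
        congr 1
        exact Finset.sum_congr rfl fun k _ => lintegral_indicator hU.measurableSet _
    _ = ENNReal.ofReal ((h ^ M / (M - 1).factorial) ^ 2 * (d + 1 : ℝ) ^ M * ρ⁻¹ ^ (d + 1)) *
          ∑ k ∈ (MIeq d M).image (· + j), ∫⁻ z in U, ‖Dmi k φ z‖ₑ ^ 2 := by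
        rw [Finset.sum_image fun a _ b _ hab => add_right_cancel hab]
    _ ≤ _ := by
        gcongr
        exact Finset.image_subset_iff.2 fun k hk => mem_MIeq.2 (hdeg hk)

lemma toReal_lintegral_enorm_sq {U : Set (Pt d)} (hU : MeasurableSet U) {f : Pt d → ℂ}
    (hf : ContinuousOn f U) :
    ∫ z in U, ‖f z‖ ^ 2 = (∫⁻ z in U, ‖f z‖ₑ ^ 2).toReal := by
  rw [integral_eq_lintegral_of_nonneg_ae (Filter.Eventually.of_forall fun _ => by positivity)
    (ContinuousOn.aestronglyMeasurable (f := fun z => ‖f z‖ ^ 2) (hf.norm.pow 2) hU)]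
  congr 1
  refine lintegral_congr fun z => ?_
  rw [ENNReal.ofReal_pow (norm_nonneg _), ofReal_norm]

lemma lintegral_enorm_sq_ne_top {U : Set (Pt d)} {f : Pt d → ℂ}
    (hf : IntegrableOn (fun z => ‖f z‖ ^ 2) U) : ∫⁻ z in U, ‖f z‖ₑ ^ 2 ≠ ⊤ := by
  have h1 := hf.hasFiniteIntegral.ne
  simpa [enorm_pow] using h1

end Remainder

lemma bramble_hilbert_const_le {M n C : ℕ} (hC : 1 ≤ C) {h ρ F : ℝ} (hρ : 0 < ρ) :
    C * ((h ^ M / F) ^ 2 * ((n : ℝ) + 1) ^ M * ρ⁻¹ ^ (n + 1)) ≤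
      (2 * C * (((n : ℝ) + 1) ^ M / F) * (h ^ M / ρ ^ (((n : ℝ) + 1) / 2))) ^ 2 := by
  have hsq : (ρ ^ (((n : ℝ) + 1) / 2)) ^ 2 = ρ ^ (n + 1) := by
    rw [← Real.rpow_natCast, ← Real.rpow_mul hρ.le, ← Real.rpow_natCast]
    congr 1
    push_cast
    ring
  have h1 : (1 : ℝ) ≤ C := mod_cast hC
  have h2 : (1 : ℝ) ≤ ((n : ℝ) + 1) ^ M := one_le_pow₀ (by linarith [Nat.cast_nonneg (α := ℝ) n])
  have h3 : (C : ℝ) * ((n : ℝ) + 1) ^ M ≤ 4 * (C * ((n : ℝ) + 1) ^ M) ^ 2 := by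
    nlinarith [mul_le_mul h1 h2 zero_le_one (by positivity)]
  calc C * ((h ^ M / F) ^ 2 * ((n : ℝ) + 1) ^ M * ρ⁻¹ ^ (n + 1))
      = C * ((n : ℝ) + 1) ^ M * ((h ^ M / F) ^ 2 * ρ⁻¹ ^ (n + 1)) := by ring
    _ ≤ 4 * (C * ((n : ℝ) + 1) ^ M) ^ 2 * ((h ^ M / F) ^ 2 * ρ⁻¹ ^ (n + 1)) := by gcongr
    _ = 4 * (C * ((n : ℝ) + 1) ^ M) ^ 2 *
        ((h ^ M / F) ^ 2 * ((ρ ^ (((n : ℝ) + 1) / 2)) ^ 2)⁻¹) := by rw [hsq, inv_pow]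
    _ = _ := by ring

/-- Bramble–Hilbert lemma with explicit constant: if `Υ` (of Euclidean
diameter `h_Υ`) is star-shaped with respect to the Euclidean ball `B` of radius `ρ·h_Υ`
(`0 < ρ ≤ 1/2`), `φ ∈ C^m(Υ)` with all derivatives of order `≤ m` in `L²(Υ)`, and `Q^mφ`
is the averaged Taylor polynomial, then for `0 ≤ s < m`,
`|φ − Q^mφ|_{H^s(Υ)} ≤ 2·C(d+s,d)·((d+1)^{m−s}/(m−s−1)!)·(h_Υ^{m−s}/ρ^{(d+1)/2})·|φ|_{H^m(Υ)}`. -/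
theorem bramble_hilbert
    (d m : ℕ) (hd : 1 ≤ d) (hm : 1 ≤ m)
    (Υ : Set (Pt d)) (hopen : IsOpen Υ) (hbdd : Bornology.IsBounded Υ)
    (hΥ : ℝ) (hdiam : IsLUB (Set.image2 (fun z w => eDist z w) Υ Υ) hΥ)
    (ρ : ℝ) (hρ0 : 0 < ρ) (hρ : ρ ≤ 1 / 2)
    (c0 : Pt d) (B : Set (Pt d)) (hB : B = {w : Pt d | eDist w c0 < ρ * hΥ})
    (hBΥ : B ⊆ Υ)
    (hstar : ∀ b ∈ B, ∀ z ∈ Υ, segment ℝ b z ⊆ Υ)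
    (φ : Pt d → ℂ) (hφ : ContDiffOn ℝ (m : ℕ) φ Υ)
    (hL2 : ∀ j : MI d, MI.deg j ≤ m → IntegrableOn (fun z => ‖Dmi j φ z‖ ^ 2) Υ volume)
    (s : ℕ) (hs : s < m) :
    Real.sqrt (∑ j ∈ MIeq d s, ∫ z in Υ,
        ‖Dmi j (fun w => φ w - (volume B).toReal⁻¹ • ∫ c in B, TaylorP m c φ w) z‖ ^ 2) ≤
      2 * (Nat.choose (d + s) d : ℝ) *
        (((d : ℝ) + 1) ^ (m - s) / (Nat.factorial (m - s - 1) : ℝ)) *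
        (hΥ ^ (m - s) / ρ ^ (((d : ℝ) + 1) / 2)) *
        Real.sqrt (∑ j ∈ MIeq d m, ∫ z in Υ, ‖Dmi j φ z‖ ^ 2) := by
  have hdist : ∀ z ∈ Υ, ∀ w ∈ Υ, eDist z w ≤ hΥ := fun z hz w hw =>
    hdiam.1 (Set.mem_image2_of_mem hz hw)
  have hne : Υ.Nonempty := by
    by_contra hemp
    rw [Set.not_nonempty_iff_eq_empty.1 hemp, Set.image2_empty_left] at hdiam
    linarith [hdiam.2 (show hΥ - 1 ∈ upperBounds ∅ by simp)]
  have hpos : 0 < hΥ := eDist_pos_of_isOpen hopen hdist hne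
  replace hB : B = eBall c0 (ρ * hΥ) := hB
  have hBo : IsOpen B := hB ▸ isOpen_eBall _ _
  have hBm : MeasurableSet B := hBo.measurableSet
  have hBb : Bornology.IsBounded B := hbdd.subset hBΥ
  have hBfin : volume B ≠ ⊤ := hBb.measure_lt_top.ne
  have hc0 : c0 ∈ B := by
    rw [hB]
    change eDist c0 c0 < ρ * hΥ
    simpa [eDist] using mul_pos hρ0 hpos
  have hB0 : volume B ≠ 0 := (hBo.measure_pos volume ⟨c0, hc0⟩).ne'
  have hρ1 : ρ < 1 := by linarith
  have hvol : volume Υ ≤ ENNReal.ofReal (((1 - ρ) / ρ) ^ (d + 1)) * volume B := by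
    have h1 := subset_eBall hopen (mul_pos hρ0 hpos) hdist (by nlinarith) (hB ▸ hBΥ)
    have h2 : hΥ - ρ * hΥ = (1 - ρ) / ρ * (ρ * hΥ) := by field_simp
    rw [h2] at h1
    rw [hB, ← volume_eBall_mul (div_pos (by linarith) hρ0)]
    exact measure_mono h1
  have hint : ∀ k : MI d, k.deg ≤ m → IntegrableOn (Dmi k φ) B := fun k hk =>
    integrableOn_Dmi hopen hφ hBm hBΥ hBfin hk (hL2 k hk)
  have hfun : (fun w => φ w - (volume B).toReal⁻¹ • ∫ c in B, TaylorP m c φ w) =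
      fun w => φ w - avgTaylor B m (fun k => Dmi k φ) w := by
    funext w
    rw [avgTaylor_eq hBb hBm (fun k hk => hint k hk.le)]
    simp only [TaylorP_eq]
  rw [hfun]
  set M := m - s
  set S := ∑ k ∈ MIeq d m, ∫ z in Υ, ‖Dmi k φ z‖ ^ 2 with hS
  set K := (hΥ ^ M / (M - 1).factorial) ^ 2 * (d + 1 : ℝ) ^ M * ρ⁻¹ ^ (d + 1)
  have hS0 : 0 ≤ S := Finset.sum_nonneg fun k _ => integral_nonneg fun z => by positivity
  have hK0 : 0 ≤ K := by positivity
  have hterm : ∀ j ∈ MIeq d s, ∫ z in Υ,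
      ‖Dmi j (fun w => φ w - avgTaylor B m (fun k => Dmi k φ) w) z‖ ^ 2 ≤ K * S := by
    intro j hj
    have hjs : j.deg = s := mem_MIeq.1 hj
    have hMj : M + j.deg = m := by omega
    have hintj : ∀ k : MI d, k.deg < M → IntegrableOn (Dmi (k + j) φ) B := fun k hk =>
      hint _ (by rw [MI.deg_add]; omega)
    have heq := Dmi_sub_avgTaylor hopen hφ hBb hBm (fun k hk => hint k hk.le) j (by omega)
    rw [hjs] at heq
    have hcont : ContinuousOn
        (fun z => Dmi j φ z - avgTaylor B M (fun k => Dmi (k + j) φ) z) Υ :=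
      (continuousOn_Dmi hopen hφ (by omega)).sub
        (differentiable_avgTaylor hBb hBm hintj).continuous.continuousOn
    rw [setIntegral_congr_fun hopen.measurableSet fun z hz => by
        simp only [heq hz]; rfl,
      toReal_lintegral_enorm_sq hopen.measurableSet hcont]
    have hle := lintegral_sub_avgTaylor_sq_le hopen hφ hMj (by omega) hBb hBm hB0 hintj hstar
      (fun z hz c hc => hdist z hz c (hBΥ hc)) hρ0 hρ1 hvol
    have hfin : ∀ k ∈ MIeq d m, ∫⁻ z in Υ, ‖Dmi k φ z‖ₑ ^ 2 ≠ ⊤ := fun k hk =>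
      lintegral_enorm_sq_ne_top (hL2 k (mem_MIeq.1 hk).le)
    refine (ENNReal.toReal_mono
      (ENNReal.mul_ne_top ENNReal.ofReal_ne_top (ENNReal.sum_ne_top.2 hfin)) hle).trans_eq ?_
    rw [ENNReal.toReal_mul, ENNReal.toReal_ofReal hK0, ENNReal.toReal_sum hfin, hS]
    congr 1
    refine Finset.sum_congr rfl fun k hk => (toReal_lintegral_enorm_sq hopen.measurableSet ?_).symm
    exact continuousOn_Dmi hopen hφ (mem_MIeq.1 hk).le
  refine Real.sqrt_le_iff.2 ⟨by positivity, ?_⟩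
  rw [mul_pow, Real.sq_sqrt hS0]
  calc _ ≤ ∑ j ∈ MIeq d s, K * S := Finset.sum_le_sum hterm
    _ = (MIeq d s).card * (K * S) := by rw [Finset.sum_const, nsmul_eq_mul]
    _ ≤ (d + s).choose d * (K * S) := by
        gcongr
        exact card_MIeq_le d s
    _ = (d + s).choose d * K * S := by ring
    _ ≤ _ := by
        gcongr
        exact bramble_hilbert_const_le (Nat.choose_pos (Nat.le_add_right d s)) hρ0

end
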